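/- For every n ≥ 1, the number of 312-avoiding permutations x ∈ S_n with x_n = n and no double descents equals the Motzkin number M_{n-1}. -/

import Mathlib

/-- `w` is (the word of) a permutation of `{1, …, n}`. -/
def IsPermWord (n : ℕ) (w : List ℕ) : Prop := w.Perm (List.range' 1 n)

/-- `w` is 312-avoiding: there are no positions `i < j < k` with `w_j < w_k < w_i`. -/
def Avoids312 (w : List ℕ) : Prop :=
  ¬ ∃ i j k : ℕ, i < j ∧ j < k ∧ k < w.length ∧
      w.getD j 0 < w.getD k 0 ∧ w.getD k 0 < w.getD i 0

/-- `w` has a double descent: three consecutive strictly decreasing entries. -/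
def HasDoubleDescent (w : List ℕ) : Prop :=
  ∃ i : ℕ, i + 2 < w.length ∧
    w.getD (i + 1) 0 < w.getD i 0 ∧ w.getD (i + 2) 0 < w.getD (i + 1) 0

/-- The Motzkin numbers: `M_0 = 1` and
`M_{n+1} = M_n + ∑_{k=0}^{n-1} M_k · M_{n-1-k}`. -/
def motzkin : ℕ → ℕ
  | 0 => 1
  | n + 1 => motzkin n + ∑ k : Fin n, motzkin k * motzkin (n - 1 - k)
decreasing_by
  · exact Nat.lt_succ_self n
  · omega
  · omega

open List in
theorem avoids312_iff_sublist (w : List ℕ) :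
    Avoids312 w ↔ ∀ x y z, [x, y, z] <+ w → ¬ (y < z ∧ z < x) := by
  constructor
  · intro h x y z hs hlt
    obtain ⟨f, hf⟩ := List.sublist_iff_exists_fin_orderEmbedding_get_eq.1 hs
    have h0 := hf ⟨0, by simp⟩
    have h1 := hf ⟨1, by simp⟩
    have h2 := hf ⟨2, by simp⟩
    simp only [List.get_eq_getElem, List.getElem_cons_zero, List.getElem_cons_succ] at h0 h1 h2
    refine h ⟨f ⟨0, by simp⟩, f ⟨1, by simp⟩, f ⟨2, by simp⟩, ?_, ?_, (f _).2, ?_, ?_⟩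
    · exact f.lt_iff_lt.2 (by simp)
    · exact f.lt_iff_lt.2 (by simp)
    · rw [List.getD_eq_getElem _ _ (f _).2, List.getD_eq_getElem _ _ (f _).2, ← h1, ← h2]
      exact hlt.1
    · rw [List.getD_eq_getElem _ _ (f _).2, List.getD_eq_getElem _ _ (f _).2, ← h0, ← h2]
      exact hlt.2
  · rintro h ⟨i, j, k, hij, hjk, hk, h1, h2⟩
    refine h (w.getD i 0) (w.getD j 0) (w.getD k 0) ?_ ⟨h1, h2⟩
    have hs := List.map_getElem_sublist (l := w)
      (is := [⟨i, by omega⟩, ⟨j, by omega⟩, ⟨k, hk⟩]) (by simp; omega)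
    have hi : i < w.length := by omega
    have hj : j < w.length := by omega
    simpa [List.getD_eq_getElem, hi, hj, hk] using hs

open List in
theorem Avoids312.sublist {u w : List ℕ} (h : Avoids312 w) (hs : u <+ w) : Avoids312 u := by
  rw [avoids312_iff_sublist] at *
  exact fun x y z h' => h x y z (h'.trans hs)

theorem avoids312_append_cons_iff {u v : List ℕ} {a : ℕ} (hu : ∀ x ∈ u, a < x)
    (hv : ∀ x ∈ v, a < x) (hd : u.Disjoint v) :
    Avoids312 (u ++ a :: v) ↔ Avoids312 u ∧ Avoids312 v ∧ ∀ x ∈ u, ∀ z ∈ v, x < z := by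
  constructor
  · intro h
    refine ⟨h.sublist (List.sublist_append_left _ _),
      h.sublist ((List.sublist_cons_self _ _).trans (List.sublist_append_right _ _)), ?_⟩
    intro x hx z hz
    by_contra hlt
    have hne : x ≠ z := fun e => hd hx (e ▸ hz)
    refine (avoids312_iff_sublist _).1 h x a z ?_ ⟨hv z hz, by omega⟩
    exact (List.singleton_sublist.2 hx).append ((List.singleton_sublist.2 hz).cons_cons a)
  · rintro ⟨h1, h2, h3⟩
    rw [avoids312_iff_sublist] at *
    rintro x y z hs ⟨hyz, hzx⟩
    obtain ⟨l₁, l₂, he, hl₁, hl₂⟩ := List.sublist_append_iff.1 hs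
    have key : x ∈ u → y ∈ u ++ a :: v → z ∈ a :: v → False := by
      intro hx hy hz
      have hay : a ≤ y := by
        simp only [List.mem_append, List.mem_cons] at hy
        rcases hy with hy | rfl | hy
        · exact (hu y hy).le
        · exact le_rfl
        · exact (hv y hy).le
      rcases List.mem_cons.1 hz with rfl | hz
      · omega
      · exact absurd (h3 x hx z hz) (by omega)
    have hy : y ∈ u ++ a :: v := hs.subset (by simp)
    match l₁, he with
    | [], he =>
      simp only [List.nil_append] at he
      subst he
      rcases List.sublist_cons_iff.1 hl₂ with h | ⟨r, hr, hrv⟩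
      · exact h2 x y z h ⟨hyz, hzx⟩
      · simp only [List.cons.injEq] at hr
        obtain ⟨rfl, rfl⟩ := hr
        have := hv z (hrv.subset (by simp))
        omega
    | [_], he =>
      simp only [List.cons_append, List.nil_append, List.cons.injEq] at he
      obtain ⟨rfl, rfl⟩ := he
      exact key (hl₁.subset (by simp)) hy (hl₂.subset (by simp))
    | [_, _], he =>
      simp only [List.cons_append, List.nil_append, List.cons.injEq] at he
      obtain ⟨rfl, rfl, rfl⟩ := he
      exact key (hl₁.subset (by simp)) hy (hl₂.subset (by simp))
    | _ :: _ :: _ :: l, he =>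
      simp only [List.cons_append, List.cons.injEq] at he
      obtain ⟨rfl, rfl, rfl, -⟩ := he
      refine h1 x y z (List.Sublist.trans ?_ hl₁) ⟨hyz, hzx⟩
      simp

theorem avoids312_append_singleton_iff {u : List ℕ} {m : ℕ} (hu : ∀ x ∈ u, x < m) :
    Avoids312 (u ++ [m]) ↔ Avoids312 u := by
  refine ⟨fun h => h.sublist (List.sublist_append_left _ _), fun h => ?_⟩
  rintro ⟨i, j, k, hij, hjk, hk, h1, h2⟩
  simp only [List.length_append, List.length_singleton] at hk
  have hi : i < u.length := by omega
  have hj : j < u.length := by omega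
  rw [List.getD_append _ _ _ _ hj] at h1
  rw [List.getD_append _ _ _ _ hi] at h2
  by_cases hk' : k < u.length
  · rw [List.getD_append _ _ _ _ hk'] at h1 h2
    exact h ⟨i, j, k, hij, hjk, hk', h1, h2⟩
  · obtain rfl : k = u.length := by omega
    rw [List.getD_eq_getElem _ _ hi] at h2
    have := hu _ (List.getElem_mem hi)
    simp at h2
    omega

theorem not_hasDoubleDescent_of_length_le {w : List ℕ} (hw : w.length ≤ 2) :
    ¬ HasDoubleDescent w := by
  rintro ⟨i, hi, -⟩
  omega

theorem hasDoubleDescent_cons_cons_cons {x y z : ℕ} {l : List ℕ} :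
    HasDoubleDescent (x :: y :: z :: l) ↔
      (y < x ∧ z < y) ∨ HasDoubleDescent (y :: z :: l) := by
  constructor
  · rintro ⟨i, hi, h1, h2⟩
    cases i with
    | zero => left; simpa using ⟨h1, h2⟩
    | succ i => right; exact ⟨i, by simpa using hi, by simpa using h1, by simpa using h2⟩
  · rintro (⟨h1, h2⟩ | ⟨i, hi, h1, h2⟩)
    · exact ⟨0, by simp, by simpa using h1, by simpa using h2⟩
    · exact ⟨i + 1, by simpa using hi, by simpa using h1, by simpa using h2⟩

theorem HasDoubleDescent.append_left {w : List ℕ} (h : HasDoubleDescent w) (u : List ℕ) :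
    HasDoubleDescent (u ++ w) := by
  obtain ⟨i, hi, h1, h2⟩ := h
  refine ⟨u.length + i, by simp; omega, ?_, ?_⟩
  · rw [add_assoc, List.getD_append_right _ _ _ _ (by omega),
      List.getD_append_right _ _ _ _ (by omega)]
    simpa using h1
  · rw [add_assoc, add_assoc, List.getD_append_right _ _ _ _ (by omega),
      List.getD_append_right _ _ _ _ (by omega)]
    simpa using h2

theorem HasDoubleDescent.append_right {w : List ℕ} (h : HasDoubleDescent w) (v : List ℕ) :
    HasDoubleDescent (w ++ v) := by
  obtain ⟨i, hi, h1, h2⟩ := h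
  refine ⟨i, by simp; omega, ?_, ?_⟩ <;>
  · rw [List.getD_append _ _ _ _ (by omega), List.getD_append _ _ _ _ (by omega)]
    assumption

theorem hasDoubleDescent_cons_iff_of_lt {a : ℕ} {v : List ℕ} (hv : ∀ x ∈ v, a < x) :
    HasDoubleDescent (a :: v) ↔ HasDoubleDescent v := by
  match v with
  | [] => simp [not_hasDoubleDescent_of_length_le]
  | [_] => simp [not_hasDoubleDescent_of_length_le]
  | y :: z :: l =>
    have := hv y (by simp)
    rw [hasDoubleDescent_cons_cons_cons]
    exact or_iff_right (by omega)

theorem hasDoubleDescent_cons_cons_iff_of_lt {a b : ℕ} {v : List ℕ} (hv : ∀ x ∈ v, a < x) :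
    HasDoubleDescent (b :: a :: v) ↔ HasDoubleDescent v := by
  rw [← hasDoubleDescent_cons_iff_of_lt hv]
  match v with
  | [] => simp [not_hasDoubleDescent_of_length_le]
  | y :: l =>
    have := hv y (by simp)
    rw [hasDoubleDescent_cons_cons_cons]
    exact or_iff_right (by omega)

theorem hasDoubleDescent_append_cons_iff_of_lt {u v : List ℕ} {m : ℕ} (hu : ∀ x ∈ u, x < m) :
    HasDoubleDescent (u ++ m :: v) ↔ HasDoubleDescent u ∨ HasDoubleDescent (m :: v) := by
  refine ⟨fun h => ?_, fun h => h.elim (·.append_right _) (·.append_left _)⟩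
  induction u with
  | nil => exact Or.inr h
  | cons x u ih =>
    have hx := hu x (by simp)
    replace ih := ih (fun y hy => hu y (by simp [hy]))
    match u with
    | [] =>
      right
      cases v with
      | nil => exact absurd h (not_hasDoubleDescent_of_length_le (by simp))
      | cons z v => exact (hasDoubleDescent_cons_cons_cons.1 h).resolve_left (by omega)
    | [y] =>
      have hy := hu y (by simp)
      have h' := (hasDoubleDescent_cons_cons_cons.1 h).resolve_left (by omega)
      exact (ih h').imp_left (·.append_left [x])
    | y :: z :: l =>
      rcases hasDoubleDescent_cons_cons_cons.1 h with h' | h'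
      · exact Or.inl (hasDoubleDescent_cons_cons_cons.2 (Or.inl h'))
      · exact (ih h').imp_left (·.append_left [x])

theorem perm_range'_of_append {u v : List ℕ} {a n : ℕ} (h : (u ++ v).Perm (List.range' a n))
    (huv : ∀ x ∈ u, ∀ z ∈ v, x < z) :
    u.Perm (List.range' a u.length) ∧ v.Perm (List.range' (a + u.length) v.length) := by
  have hn : u.length + v.length = n := by simpa using h.length_eq
  have hs : (u.insertionSort (· ≤ ·) ++ v.insertionSort (· ≤ ·)) = List.range' a n := by
    refine List.Perm.eq_of_pairwise' (r := (· ≤ ·)) ?_ ?_ ?_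
    · refine List.pairwise_append.2 ⟨List.pairwise_insertionSort _ _,
        List.pairwise_insertionSort _ _, ?_⟩
      intro x hx z hz
      exact (huv x (by simpa using hx) z (by simpa using hz)).le
    · exact List.pairwise_le_range'
    · exact ((List.perm_insertionSort _ _).append (List.perm_insertionSort _ _)).trans h
  rw [← hn, ← List.range'_append_1] at hs
  obtain ⟨h1, h2⟩ := List.append_inj hs (by simp)
  exact ⟨h1 ▸ (List.perm_insertionSort _ _).symm, h2 ▸ (List.perm_insertionSort _ _).symm⟩

/-- The 312-avoiding words without double descents on the alphabet `{a, …, a + n - 1}`, each letter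
being used exactly once. -/
def AvoidingWords (a n : ℕ) : Set (List ℕ) :=
  {w | w.Perm (List.range' a n) ∧ Avoids312 w ∧ ¬ HasDoubleDescent w}

theorem mem_bounds_of_perm_range' {w : List ℕ} {a n x : ℕ} (h : w.Perm (List.range' a n))
    (hx : x ∈ w) : a ≤ x ∧ x < a + n := by
  simpa [List.mem_range'_1] using h.subset hx

theorem cons_mem_avoidingWords_iff {a n : ℕ} {v : List ℕ} :
    a :: v ∈ AvoidingWords a (n + 1) ↔ v ∈ AvoidingWords (a + 1) n := by
  simp only [AvoidingWords, Set.mem_ofPred_eq, List.range'_succ, List.perm_cons]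
  refine and_congr_right fun hp => ?_
  have hv : ∀ x ∈ v, a < x := fun x hx => (mem_bounds_of_perm_range' hp hx).1
  have := avoids312_append_cons_iff (u := []) (by simp) hv (by simp)
  rw [hasDoubleDescent_cons_iff_of_lt hv]
  simp_all [avoids312_iff_sublist []]

theorem append_mem_avoidingWords {a k l : ℕ} {u v : List ℕ} (hu : u ∈ AvoidingWords (a + 1) k)
    (hv : v ∈ AvoidingWords (a + k + 2) l) :
    u ++ (a + k + 1) :: a :: v ∈ AvoidingWords a (k + l + 2) := by
  obtain ⟨hpu, hau, hdu⟩ := hu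
  obtain ⟨hpv, hav, hdv⟩ := hv
  have hbu : ∀ x ∈ u, a + 1 ≤ x ∧ x < a + 1 + k := fun x => mem_bounds_of_perm_range' hpu
  have hbv : ∀ x ∈ v, a + k + 2 ≤ x ∧ x < a + k + 2 + l := fun x => mem_bounds_of_perm_range' hpv
  have hbm : ∀ x ∈ u ++ [a + k + 1], a < x ∧ x < a + k + 2 := by
    intro x hx
    simp only [List.mem_append, List.mem_singleton] at hx
    rcases hx with hx | rfl
    · have := hbu x hx; omega
    · omega
  have hav' : ∀ x ∈ v, a < x := fun x hx => by have := hbv x hx; omega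
  have hlt : ∀ x ∈ u ++ [a + k + 1], ∀ z ∈ v, x < z := fun x hx z hz => by
    have := hbm x hx; have := hbv z hz; omega
  have hum : ∀ x ∈ u, x < a + k + 1 := fun x hx => by have := hbu x hx; omega
  refine ⟨?_, ?_, ?_⟩
  · have e : List.range' a (k + l + 2) =
        a :: (List.range' (a + 1) k ++ (a + k + 1) :: List.range' (a + k + 2) l) := by
      rw [show k + l + 2 = (k + (l + 1)) + 1 by omega, List.range'_succ, ← List.range'_append,
        List.range'_succ, show a + 1 + 1 * k = a + k + 1 by omega]
    rw [e]
    have : (u ++ (a + k + 1) :: a :: v).Perm (a :: (u ++ (a + k + 1) :: v)) := by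
      simpa using List.perm_middle (a := a) (l₁ := u ++ [a + k + 1]) (l₂ := v)
    exact this.trans ((hpu.append (hpv.cons _)).cons _)
  · rw [show u ++ (a + k + 1) :: a :: v = (u ++ [a + k + 1]) ++ a :: v by simp]
    refine (avoids312_append_cons_iff (fun x hx => (hbm x hx).1) hav' ?_).2 ⟨?_, hav, hlt⟩
    · exact fun x hx hz => lt_irrefl _ (hlt x hx x hz)
    · exact (avoids312_append_singleton_iff hum).2 hau
  · rw [hasDoubleDescent_append_cons_iff_of_lt hum, hasDoubleDescent_cons_cons_iff_of_lt hav']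
    exact not_or.2 ⟨hdu, hdv⟩

theorem lt_of_avoids312_of_not_hasDoubleDescent {u v : List ℕ} {m a : ℕ} (hn : (u ++ [m]).Nodup)
    (ha : Avoids312 (u ++ [m])) (hd : ¬ HasDoubleDescent (u ++ m :: a :: v)) (hm : a < m) :
    ∀ x ∈ u, x < m := by
  rcases List.eq_nil_or_concat' u with rfl | ⟨t, p, rfl⟩
  · simp
  have hne : ∀ x ∈ t ++ [p], x ≠ m := by
    rintro x hx rfl
    exact (List.nodup_append.1 hn).2.2 x hx x (by simp) rfl
  have hp : p < m := by
    have := hne p (by simp)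
    by_contra hlt
    refine hd ?_
    have : HasDoubleDescent ([p, m, a] ++ v) :=
      hasDoubleDescent_cons_cons_cons.2 (Or.inl ⟨by omega, hm⟩)
    simpa using this.append_left t
  intro x hx
  have hxm := hne x hx
  rcases List.mem_append.1 hx with hx | hx
  · by_contra hlt
    refine (avoids312_iff_sublist _).1 ha x p m ?_ ⟨hp, by omega⟩
    simpa using (List.singleton_sublist.2 hx).append (List.Sublist.refl [p, m])
  · simpa [List.mem_singleton.1 hx] using hp

theorem mem_avoidingWords_succ_iff {a n : ℕ} {w : List ℕ} :
    w ∈ AvoidingWords a (n + 1) ↔ (∃ v ∈ AvoidingWords (a + 1) n, a :: v = w) ∨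
      ∃ k : Fin n, ∃ u ∈ AvoidingWords (a + 1) k, ∃ v ∈ AvoidingWords (a + k + 2) (n - 1 - k),
        u ++ (a + k + 1) :: a :: v = w := by
  constructor
  · intro hw
    obtain ⟨s, v, rfl⟩ := List.append_of_mem (hw.1.symm.subset (List.mem_range'_1.2 (by simp)) :
      a ∈ w)
    rcases List.eq_nil_or_concat' s with rfl | ⟨u, m, rfl⟩
    · exact Or.inl ⟨v, cons_mem_avoidingWords_iff.1 hw, rfl⟩
    right
    obtain ⟨hp, ha, hd⟩ := hw
    have hp' : ((u ++ [m]) ++ v).Perm (List.range' (a + 1) n) := by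
      rw [List.range'_succ] at hp
      exact (List.perm_middle.symm.trans hp).cons_inv
    have hn : ((u ++ [m]) ++ v).Nodup := hp'.nodup_iff.2 List.nodup_range'
    have hb : ∀ x ∈ (u ++ [m]) ++ v, a < x := fun x hx => (mem_bounds_of_perm_range' hp' hx).1
    obtain ⟨ha₁, ha₂, hlt⟩ := (avoids312_append_cons_iff
      (fun x hx => hb x (List.mem_append_left _ hx))
      (fun x hx => hb x (List.mem_append_right _ hx)) (List.disjoint_of_nodup_append hn)).1 ha
    simp only [List.append_assoc, List.singleton_append] at hd
    have hum := lt_of_avoids312_of_not_hasDoubleDescent hn.of_append_left ha₁ hd (hb m (by simp))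
    rw [hasDoubleDescent_append_cons_iff_of_lt hum,
      hasDoubleDescent_cons_cons_iff_of_lt (fun x hx => hb x (List.mem_append_right _ hx)),
      not_or] at hd
    have hlen : u.length + 1 + v.length = n := by
      have := hp'.length_eq
      simp at this
      omega
    obtain ⟨hp₁, hp₂⟩ := perm_range'_of_append hp' hlt
    obtain ⟨hp₃, hp₄⟩ := perm_range'_of_append hp₁ (by simpa using hum)
    have hm : m = a + u.length + 1 := by
      have := mem_bounds_of_perm_range' hp₄ (List.mem_singleton_self m)
      simp at this
      omega
    refine ⟨⟨u.length, by omega⟩, u, ⟨hp₃, ha₁.sublist (List.sublist_append_left _ _), hd.1⟩,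
      v, ⟨?_, ha₂, hd.2⟩, by simp [hm]⟩
    convert hp₂ using 2
    · simp; omega
    · simp; omega
  · rintro (⟨v, hv, rfl⟩ | ⟨⟨k, hk⟩, u, hu, v, hv, rfl⟩)
    · exact cons_mem_avoidingWords_iff.2 hv
    · convert append_mem_avoidingWords hu hv using 2
      simp only
      omega

theorem exists_finset_avoidingWords (n : ℕ) :
    ∀ a, ∃ F : Finset (List ℕ), (∀ w, w ∈ F ↔ w ∈ AvoidingWords a n) ∧ F.card = motzkin n := by
  induction n using Nat.strong_induction_on with
  | _ n ih =>
  intro a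
  cases n with
  | zero =>
    refine ⟨{[]}, fun w => ?_, by simp [motzkin]⟩
    simp only [AvoidingWords, Finset.mem_singleton, Set.mem_ofPred_eq, List.range'_zero,
      List.perm_nil]
    refine ⟨?_, fun h => h.1⟩
    rintro rfl
    exact ⟨rfl, by simp [avoids312_iff_sublist], not_hasDoubleDescent_of_length_le (by simp)⟩
  | succ n =>
    choose F hF hcard using ih
    let A : Finset (List ℕ) := (F n (by omega) (a + 1)).image (a :: ·)
    let B (k : Fin n) : Finset (List ℕ) :=
      Finset.image₂ (fun u v => u ++ (a + k + 1) :: a :: v) (F k (by omega) (a + 1))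
        (F (n - 1 - k) (by omega) (a + k + 2))
    have hA : ∀ w ∈ A, w.idxOf a = 0 := by
      intro w hw
      obtain ⟨v, -, rfl⟩ := Finset.mem_image.1 hw
      simp
    have hB : ∀ k, ∀ w ∈ B k, w.idxOf a = k + 1 := by
      intro k w hw
      obtain ⟨u, hu, v, -, rfl⟩ := Finset.mem_image₂.1 hw
      have hp := ((hF _ _ _ _).1 hu).1
      have hau : a ∉ u := fun h => by
        have := mem_bounds_of_perm_range' hp h
        omega
      have hl : u.length = k := by simpa using hp.length_eq
      rw [List.idxOf_append_of_notMem hau, List.idxOf_cons_ne _ (by omega), hl]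
      simp
    have hcA : A.card = motzkin n := by
      rw [Finset.card_image_of_injective _ List.cons_injective, hcard]
    have hcB : ∀ k, (B k).card = motzkin k * motzkin (n - 1 - k) := by
      intro k
      rw [← hcard k (by omega) (a + 1), ← hcard (n - 1 - k) (by omega) (a + k + 2)]
      refine Finset.card_image₂_iff.2 ?_
      rintro ⟨u, v⟩ h ⟨u', v'⟩ h' he
      have hl : u.length = k := by simpa using ((hF _ _ _ _).1 h.1).1.length_eq
      have hl' : u'.length = k := by simpa using ((hF _ _ _ _).1 h'.1).1.length_eq
      obtain ⟨h1, h2⟩ := List.append_inj he (hl.trans hl'.symm)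
      exact Prod.ext h1 (by simpa using h2)
    refine ⟨A ∪ Finset.univ.biUnion B, fun w => ?_, ?_⟩
    · rw [mem_avoidingWords_succ_iff]
      simp only [A, B, Finset.mem_union, Finset.mem_image, Finset.mem_biUnion, Finset.mem_univ,
        true_and, Finset.mem_image₂, hF]
    · rw [Finset.card_union_of_disjoint, Finset.card_biUnion, hcA, motzkin]
      · simp only [hcB]
      · intro k _ l _ hkl
        refine Finset.disjoint_left.2 fun w hk hl => hkl (Fin.ext ?_)
        have := hB k w hk
        have := hB l w hl
        omega
      · refine Finset.disjoint_left.2 fun w hw hw' => ?_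
        obtain ⟨k, -, hk⟩ := Finset.mem_biUnion.1 hw'
        have := hA w hw
        have := hB k w hk
        omega

theorem ncard_avoidingWords (a n : ℕ) : (AvoidingWords a n).ncard = motzkin n := by
  obtain ⟨F, hF, hc⟩ := exists_finset_avoidingWords n a
  rw [← hc, ← Set.ncard_coe_finset]
  congr 1
  ext w
  exact (hF w).symm

/-- **Theorem (Statement 14).** For every `n ≥ 1`, the number of 312-avoiding
permutations `x ∈ S_n` with `x_n = n` and no double descents is the Motzkin
number `M_{n-1}`. -/
theorem card_avoid312_no_double_descent (n : ℕ) (hn : 1 ≤ n) :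
    Set.ncard {w : List ℕ | IsPermWord n w ∧ Avoids312 w ∧
        w.getD (n - 1) 0 = n ∧ ¬ HasDoubleDescent w} =
      motzkin (n - 1) := by
  obtain ⟨m, rfl⟩ : ∃ m, n = m + 1 := ⟨n - 1, by omega⟩
  rw [Nat.add_sub_cancel, ← ncard_avoidingWords 1 m,
    ← Set.ncard_image_of_injective (AvoidingWords 1 m) (List.append_left_injective [m + 1])]
  have hperm : ∀ u : List ℕ, IsPermWord (m + 1) (u ++ [m + 1]) ↔ u.Perm (List.range' 1 m) := by
    intro u
    rw [IsPermWord, List.range'_1_concat, Nat.add_comm 1 m, List.perm_append_right_iff]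
  have key : ∀ u : List ℕ, u.Perm (List.range' 1 m) →
      ((Avoids312 (u ++ [m + 1]) ↔ Avoids312 u) ∧
        (HasDoubleDescent (u ++ [m + 1]) ↔ HasDoubleDescent u)) := by
    intro u hu
    have hb : ∀ x ∈ u, x < m + 1 := fun x hx => by
      have := mem_bounds_of_perm_range' hu hx
      omega
    refine ⟨avoids312_append_singleton_iff hb, ?_⟩
    rw [hasDoubleDescent_append_cons_iff_of_lt hb]
    exact or_iff_left (not_hasDoubleDescent_of_length_le (by simp))
  congr 1
  ext w
  constructor
  · rintro ⟨hp, ha, hl, hd⟩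
    have hlen : w.length = m + 1 := by simpa using List.Perm.length_eq hp
    rcases List.eq_nil_or_concat' w with rfl | ⟨u, x, rfl⟩
    · simp at hlen
    obtain rfl : u.length = m := by simpa using hlen
    obtain rfl : x = u.length + 1 := by simpa using hl
    have hu := (hperm u).1 hp
    exact ⟨u, ⟨hu, (key u hu).1.1 ha, fun h => hd ((key u hu).2.2 h)⟩, rfl⟩
  · rintro ⟨u, ⟨hu, ha, hd⟩, rfl⟩
    have hlen : u.length = m := by simpa using hu.length_eq
    exact ⟨(hperm u).2 hu, (key u hu).1.2 ha, by simp [← hlen],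
      fun h => hd ((key u hu).2.1 h)⟩
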